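/- arXiv:1308.4247 — 2 statements merged into one kernel-verified Lean document; each statement's English description precedes it below -/
import Mathlib

section
/- Fix 0 < ε ≤ 1/3. There exist constants C > 0 and λ₀ > 0, depending only on ε, such that for every λ ≥ λ₀, all dyadic integers K, L ≥ 1, and every z ∈ S_K, the number of medians w ∈ S_L with |w − z| < λ^ε is at most C·L·B_λ. -/
open MeasureTheory Real

noncomputable section

/-- The Euclidean norm of a vector in `ℝ × ℝ`. -/
def e2 (x : ℝ × ℝ) : ℝ := Real.sqrt (x.1 ^ 2 + x.2 ^ 2)

/-- The integer vector `μ` viewed as a vector in `ℝ × ℝ`. -/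
def iv (μ : ℤ × ℤ) : ℝ × ℝ := ((μ.1 : ℝ), (μ.2 : ℝ))

/-- The set of lattice points on the circle of radius `lam`. -/
def Elat (lam : ℝ) : Finset (ℤ × ℤ) := by
  classical
  exact (Finset.Icc (-⌈lam⌉, -⌈lam⌉) (⌈lam⌉, ⌈lam⌉)).filter
    (fun μ => (μ.1 : ℝ) ^ 2 + (μ.2 : ℝ) ^ 2 = lam ^ 2)

/-- `B_lam`: the maximal number of lattice points on the circle of radius `lam`
lying in an arc of length `√lam`. -/
def Bmax (lam : ℝ) : ℕ := by
  classical
  exact sSup {n : ℕ | ∃ x : ℝ × ℝ, e2 x = lam ∧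
    n = ((Elat lam).filter fun ξ => e2 (iv ξ - x) ≤ Real.sqrt lam).card}

/-- `Z_lam`: the set of medians `(μ+ν)/2` of pairs of lattice points on the circle
of radius `lam`. -/
def Zmed (lam : ℝ) : Finset (ℝ × ℝ) := by
  classical
  exact ((Elat lam) ×ˢ (Elat lam)).image fun p => ((1:ℝ)/2) • (iv p.1 + iv p.2)

/-- `Δ(z) = √(lam² - |z|²)`, half the distance between the two points of the circle of
radius `lam` with midpoint `z`. -/
def Del (lam : ℝ) (z : ℝ × ℝ) : ℝ := Real.sqrt (lam ^ 2 - (e2 z) ^ 2)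

/-- Rotation of a plane vector by `π/2`. -/
def perp (z : ℝ × ℝ) : ℝ × ℝ := (-z.2, z.1)

/-- `μ₊(z) = z + Δ(z)·z^⊥/|z^⊥|`, one of the two points on the circle of radius `lam`
whose midpoint is `z`. -/
def mup (lam : ℝ) (z : ℝ × ℝ) : ℝ × ℝ := z + (Del lam z / e2 z) • perp z

/-- The dyadic class `S_K = {z ∈ Z_lam : |z| ≥ lam/2, K√lam ≤ Δ(z) < 2K√lam}`. -/
def SK (lam K : ℝ) : Finset (ℝ × ℝ) := by
  classical
  exact (Zmed lam).filter fun z => lam / 2 ≤ e2 z ∧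
    K * Real.sqrt lam ≤ Del lam z ∧ Del lam z < 2 * K * Real.sqrt lam

/-- The number of medians of `S_L` within distance `lam^ε` of `z`. -/
def nearSKCount (lam ε K : ℝ) (z : ℝ × ℝ) : ℕ := by
  classical
  exact ((SK lam K).filter fun w => e2 (w - z) < lam ^ ε).card

lemma sq_e2 (x : ℝ × ℝ) : e2 x ^ 2 = x.1 ^ 2 + x.2 ^ 2 :=
  Real.sq_sqrt (by positivity)

lemma e2_nonneg (x : ℝ × ℝ) : 0 ≤ e2 x := Real.sqrt_nonneg _

lemma abs_fst_le_e2 (x : ℝ × ℝ) : |x.1| ≤ e2 x :=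
  Real.abs_le_sqrt (by nlinarith [sq_nonneg x.2])

lemma abs_snd_le_e2 (x : ℝ × ℝ) : |x.2| ≤ e2 x :=
  Real.abs_le_sqrt (by nlinarith [sq_nonneg x.1])

lemma sq_add_sq_of_mem_Elat {lam : ℝ} {μ : ℤ × ℤ} (h : μ ∈ Elat lam) :
    (μ.1 : ℝ) ^ 2 + (μ.2 : ℝ) ^ 2 = lam ^ 2 := by
  classical
  exact (Finset.mem_filter.1 h).2

lemma e2_iv_of_mem_Elat {lam : ℝ} (hlam : 0 ≤ lam) {μ : ℤ × ℤ} (h : μ ∈ Elat lam) :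
    e2 (iv μ) = lam := by
  simp only [e2, iv, sq_add_sq_of_mem_Elat h, Real.sqrt_sq hlam]

/-- On an arc of the circle where the second coordinate is dominated by the first, and the
first has constant sign, the first coordinate is a `1`-Lipschitz function of the second. -/
lemma sq_sub_le_sq_sub_of_circle {x y x' y' R : ℝ} (hR : 0 < R)
    (h : x ^ 2 + y ^ 2 = R ^ 2) (h' : x' ^ 2 + y' ^ 2 = R ^ 2)
    (hxy : |y| ≤ |x|) (hxy' : |y'| ≤ |x'|) (hs : 0 ≤ x ↔ 0 ≤ x') :
    (x - x') ^ 2 ≤ (y - y') ^ 2 := by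
  have hxne : x ≠ 0 := by
    rintro rfl
    have hy : y = 0 := by simpa using hxy
    subst hy
    nlinarith [pow_pos hR 2]
  have habs : |x + x'| = |x| + |x'| := by
    by_cases hx : 0 ≤ x
    · exact abs_add_eq_add_abs_iff _ _ |>.2 (Or.inl ⟨hx, hs.1 hx⟩)
    · exact abs_add_eq_add_abs_iff _ _ |>.2
        (Or.inr ⟨(not_le.1 hx).le, (not_le.1 fun hx' => hx (hs.2 hx')).le⟩)
  have hpos : 0 < |x + x'| := by
    rw [habs]
    have := abs_pos.2 hxne
    positivity
  have hsum : |y + y'| ≤ |x + x'| := by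
    rw [habs]
    exact (abs_add_le y y').trans (add_le_add hxy hxy')
  have hmul : |x - x'| * |x + x'| = |y - y'| * |y + y'| := by
    rw [← abs_mul, ← abs_mul, abs_eq_abs]
    right
    linear_combination h - h'
  have hle : |x - x'| * |x + x'| ≤ |y - y'| * |x + x'| := by
    rw [hmul]
    gcongr
  exact sq_le_sq.2 (le_of_mul_le_mul_right hle hpos)

lemma abs_sub_lt_of_floor_eq {a b c r : ℝ} (hr : 0 < r)
    (h : ⌊2 * (a - c) / r⌋ = ⌊2 * (b - c) / r⌋) : |a - b| < r / 2 := by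
  have h1 := Int.abs_sub_lt_one_of_floor_eq_floor h
  have h2 : 2 * (a - c) / r - 2 * (b - c) / r = (a - b) / (r / 2) := by
    field_simp
    ring
  rw [h2, abs_div, abs_of_pos (half_pos hr), div_lt_one (half_pos hr)] at h1
  exact h1

lemma floor_mem_Icc_of_abs_sub_le {a c r : ℝ} (hr : 0 < r) {M : ℕ} (h : |a - c| ≤ M * r) :
    ⌊2 * (a - c) / r⌋ ∈ Finset.Icc (-(2 * M : ℤ)) (2 * M) := by
  obtain ⟨h1, h2⟩ := abs_le.1 h
  rw [Finset.mem_Icc]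
  constructor
  · rw [Int.le_floor, le_div_iff₀ hr]
    push_cast
    linarith
  · have h3 : 2 * (a - c) / r ≤ ((2 * M : ℤ) : ℝ) := by
      rw [div_le_iff₀ hr]
      push_cast
      linarith
    exact_mod_cast (Int.floor_le _).trans h3

/-- A set of lattice points on a circle lying in a box of half-side `M * r` has at most
`4 * (4 * M + 1) * N` elements if its subsets of diameter at most `r` have at most `N`. -/
lemma card_le_of_card_le_of_diam_le {lam r : ℝ} (hlam : 0 < lam) (hr : 0 < r) (M N : ℕ)
    (c : ℝ × ℝ) (A : Finset (ℤ × ℤ)) (hA : A ⊆ Elat lam)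
    (h1 : ∀ μ ∈ A, |(μ.1 : ℝ) - c.1| ≤ M * r) (h2 : ∀ μ ∈ A, |(μ.2 : ℝ) - c.2| ≤ M * r)
    (hN : ∀ S ⊆ A, (∀ μ ∈ S, ∀ ν ∈ S, e2 (iv ν - iv μ) ≤ r) → S.card ≤ N) :
    A.card ≤ N * (4 * (4 * M + 1)) := by
  classical
  let f : ℤ × ℤ → Bool × Bool × ℤ := fun μ =>
    if |(μ.2 : ℝ)| ≤ |(μ.1 : ℝ)| then
      (true, decide (0 ≤ (μ.1 : ℝ)), ⌊2 * ((μ.2 : ℝ) - c.2) / r⌋)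
    else (false, decide (0 ≤ (μ.2 : ℝ)), ⌊2 * ((μ.1 : ℝ) - c.1) / r⌋)
  let t : Finset (Bool × Bool × ℤ) :=
    Finset.univ ×ˢ (Finset.univ ×ˢ Finset.Icc (-(2 * M : ℤ)) (2 * M))
  have ht : t.card = 4 * (4 * M + 1) := by
    simp only [t, Finset.card_product, Int.card_Icc, Finset.card_univ, Fintype.card_bool]
    omega
  have hf : ∀ μ ∈ A, f μ ∈ t := by
    intro μ hμ
    simp only [f, t]
    split_ifs
    · simpa only [Finset.mem_product, Finset.mem_univ, true_and] using
        floor_mem_Icc_of_abs_sub_le hr (h2 μ hμ)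
    · simpa only [Finset.mem_product, Finset.mem_univ, true_and] using
        floor_mem_Icc_of_abs_sub_le hr (h1 μ hμ)
  rw [← ht]
  refine Finset.card_le_mul_card_image_of_maps_to hf N fun b _ => ?_
  refine hN _ (Finset.filter_subset _ _) fun μ hμ ν hν => ?_
  obtain ⟨hμA, hμb⟩ := Finset.mem_filter.1 hμ
  obtain ⟨hνA, hνb⟩ := Finset.mem_filter.1 hν
  have hfe : f ν = f μ := hνb.trans hμb.symm
  have hcμ := sq_add_sq_of_mem_Elat (hA hμA)
  have hcν := sq_add_sq_of_mem_Elat (hA hνA)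
  have hsq : ((ν.1 : ℝ) - μ.1) ^ 2 + ((ν.2 : ℝ) - μ.2) ^ 2 ≤ r ^ 2 := by
    simp only [f] at hfe
    split_ifs at hfe with hv hm hm
    · simp only [Prod.mk.injEq, true_and, decide_eq_decide] at hfe
      have hle := sq_sub_le_sq_sub_of_circle hlam hcν hcμ hv hm hfe.1
      have hlt := abs_sub_lt_of_floor_eq hr hfe.2
      have := sq_le_sq' (abs_lt.1 hlt).1.le (abs_lt.1 hlt).2.le
      nlinarith
    · simp at hfe
    · simp at hfe
    · simp only [Prod.mk.injEq, true_and, decide_eq_decide] at hfe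
      rw [add_comm] at hcμ hcν
      have hle := sq_sub_le_sq_sub_of_circle hlam hcν hcμ (not_le.1 hv).le (not_le.1 hm).le hfe.1
      have hlt := abs_sub_lt_of_floor_eq hr hfe.2
      have := sq_le_sq' (abs_lt.1 hlt).1.le (abs_lt.1 hlt).2.le
      nlinarith
  exact Real.sqrt_le_iff.2 ⟨hr.le, hsq⟩

/-- The circumradius formula `(abc)² = 4 R² (2 · area)²` for a triangle with vertices
`a`, `a + u`, `a + v` on a circle of radius `R` centred at the origin. -/
lemma circumradius_identity {a₁ a₂ u₁ u₂ v₁ v₂ R : ℝ} (ha : a₁ ^ 2 + a₂ ^ 2 = R ^ 2)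
    (hu : (a₁ + u₁) ^ 2 + (a₂ + u₂) ^ 2 = R ^ 2) (hv : (a₁ + v₁) ^ 2 + (a₂ + v₂) ^ 2 = R ^ 2) :
    4 * R ^ 2 * (u₁ * v₂ - u₂ * v₁) ^ 2 =
      (u₁ ^ 2 + u₂ ^ 2) * (v₁ ^ 2 + v₂ ^ 2) * ((u₁ - v₁) ^ 2 + (u₂ - v₂) ^ 2) := by
  have hau : 2 * (a₁ * u₁ + a₂ * u₂) = -(u₁ ^ 2 + u₂ ^ 2) := by linear_combination hu - ha
  have hav : 2 * (a₁ * v₁ + a₂ * v₂) = -(v₁ ^ 2 + v₂ ^ 2) := by linear_combination hv - ha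
  calc 4 * R ^ 2 * (u₁ * v₂ - u₂ * v₁) ^ 2
      = (2 * (a₁ * u₁ + a₂ * u₂) * v₁ - 2 * (a₁ * v₁ + a₂ * v₂) * u₁) ^ 2 +
        (2 * (a₁ * u₁ + a₂ * u₂) * v₂ - 2 * (a₁ * v₁ + a₂ * v₂) * u₂) ^ 2 := by
        rw [← ha]; ring
    _ = _ := by rw [hau, hav]; ring

lemma card_le_two_of_diam_le {lam r : ℝ} (hr : r ^ 3 = lam)
    (S : Finset (ℤ × ℤ)) (hS : S ⊆ Elat lam)
    (hd : ∀ μ ∈ S, ∀ ν ∈ S, e2 (iv ν - iv μ) ≤ r) : S.card ≤ 2 := by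
  by_contra! hcard
  obtain ⟨a, ha, b, hb, c, hc, hab, hac, hbc⟩ := Finset.two_lt_card.1 hcard
  have hdist : ∀ {μ ν : ℤ × ℤ}, μ ∈ S → ν ∈ S →
      ((ν.1 : ℝ) - μ.1) ^ 2 + ((ν.2 : ℝ) - μ.2) ^ 2 ≤ r ^ 2 := by
    intro μ ν hμ hν
    have h := pow_le_pow_left₀ (e2_nonneg _) (hd μ hμ ν hν) 2
    rwa [sq_e2] at h
  have hpos : ∀ {μ ν : ℤ × ℤ}, μ ≠ ν → 0 < ((ν.1 : ℝ) - μ.1) ^ 2 + ((ν.2 : ℝ) - μ.2) ^ 2 := by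
    intro μ ν hne
    by_contra! h
    refine hne (Prod.ext ?_ ?_)
    · have : ((ν.1 : ℝ) - μ.1) ^ 2 = 0 := by
        nlinarith [sq_nonneg ((ν.1 : ℝ) - μ.1), sq_nonneg ((ν.2 : ℝ) - μ.2)]
      exact_mod_cast (sub_eq_zero.1 (pow_eq_zero_iff two_ne_zero |>.1 this)).symm
    · have : ((ν.2 : ℝ) - μ.2) ^ 2 = 0 := by
        nlinarith [sq_nonneg ((ν.1 : ℝ) - μ.1), sq_nonneg ((ν.2 : ℝ) - μ.2)]
      exact_mod_cast (sub_eq_zero.1 (pow_eq_zero_iff two_ne_zero |>.1 this)).symm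
  have hid := circumradius_identity (a₁ := a.1) (a₂ := a.2) (u₁ := (b.1 : ℝ) - a.1)
    (u₂ := (b.2 : ℝ) - a.2) (v₁ := (c.1 : ℝ) - a.1) (v₂ := (c.2 : ℝ) - a.2)
    (sq_add_sq_of_mem_Elat (hS ha))
    (by simpa using sq_add_sq_of_mem_Elat (hS hb))
    (by simpa using sq_add_sq_of_mem_Elat (hS hc))
  rw [sub_sub_sub_cancel_right, sub_sub_sub_cancel_right] at hid
  have hprod := mul_pos (mul_pos (hpos hab) (hpos hac)) (hpos hbc.symm)
  have hle : 4 * lam ^ 2 * (((b.1 : ℝ) - a.1) * (c.2 - a.2) - (b.2 - a.2) * (c.1 - a.1)) ^ 2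
      ≤ lam ^ 2 := by
    rw [hid]
    calc _ ≤ r ^ 2 * r ^ 2 * r ^ 2 := by
          gcongr
          · exact hdist ha hb
          · exact hdist ha hc
          · exact hdist hc hb
      _ = lam ^ 2 := by rw [← hr]; ring
  rw [← hid] at hprod
  set D : ℤ := (b.1 - a.1) * (c.2 - a.2) - (b.2 - a.2) * (c.1 - a.1) with hD
  have hcast : ((b.1 : ℝ) - a.1) * (c.2 - a.2) - (b.2 - a.2) * (c.1 - a.1) = D := by
    rw [hD]; push_cast; ring
  rw [hcast] at hprod hle
  have hD0 : D ≠ 0 := by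
    intro h
    rw [h] at hprod
    simp at hprod
  have hD1 : (1 : ℝ) ≤ (D : ℝ) ^ 2 := by
    have : 1 ≤ D ^ 2 := Int.add_one_le_iff.2 (sq_pos_of_ne_zero hD0)
    exact_mod_cast this
  nlinarith [sq_nonneg lam]

lemma card_le_Bmax {lam : ℝ} (hlam : 0 ≤ lam) (S : Finset (ℤ × ℤ)) (hS : S ⊆ Elat lam)
    (hd : ∀ μ ∈ S, ∀ ν ∈ S, e2 (iv ν - iv μ) ≤ Real.sqrt lam) : S.card ≤ Bmax lam := by
  classical
  obtain rfl | ⟨μ, hμ⟩ := S.eq_empty_or_nonempty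
  · simp
  have hsub : S ⊆ (Elat lam).filter fun ξ => e2 (iv ξ - iv μ) ≤ Real.sqrt lam :=
    fun ν hν => Finset.mem_filter.2 ⟨hS hν, hd μ hμ ν hν⟩
  refine (Finset.card_le_card hsub).trans ?_
  unfold Bmax
  refine le_csSup ⟨(Elat lam).card, ?_⟩ ⟨iv μ, e2_iv_of_mem_Elat hlam (hS hμ), ?_⟩
  · rintro n ⟨x, -, rfl⟩
    exact Finset.card_filter_le _ _
  · congr!

/-- A lattice point of the circle is at distance `Δ(w)` from any median `w` it generates. -/
lemma e2_sub_median_le_Del {lam : ℝ} {μ ν : ℤ × ℤ} (hμ : μ ∈ Elat lam) (hν : ν ∈ Elat lam) :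
    e2 (iv μ - ((1 : ℝ) / 2) • (iv μ + iv ν)) ≤ Del lam (((1 : ℝ) / 2) • (iv μ + iv ν)) := by
  refine Real.sqrt_le_sqrt (le_of_eq ?_)
  rw [sq_e2]
  simp only [iv, Prod.fst_sub, Prod.snd_sub, Prod.smul_fst, Prod.smul_snd, Prod.fst_add,
    Prod.snd_add, smul_eq_mul]
  linear_combination (1 / 2 : ℝ) * sq_add_sq_of_mem_Elat hμ +
    (1 / 2 : ℝ) * sq_add_sq_of_mem_Elat hν

lemma rpow_one_third_pow_three {lam : ℝ} (hlam : 0 ≤ lam) : (lam ^ (1 / 3 : ℝ)) ^ 3 = lam := by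
  rw [← Real.rpow_natCast, ← Real.rpow_mul hlam]
  norm_num

/-- Given one endpoint `μ`, boundedly many `ν` give a median within `lam ^ (1 / 3)` of `z`. -/
lemma card_filter_median_near_le {lam : ℝ} (hlam : 0 < lam) (z : ℝ × ℝ) (μ : ℤ × ℤ)
    (A : Finset (ℤ × ℤ)) (hA : A ⊆ Elat lam)
    (hz : ∀ ν ∈ A, e2 (((1 : ℝ) / 2) • (iv μ + iv ν) - z) ≤ lam ^ (1 / 3 : ℝ)) :
    A.card ≤ 72 := by
  have hr : 0 < lam ^ (1 / 3 : ℝ) := Real.rpow_pos_of_pos hlam _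
  refine card_le_of_card_le_of_diam_le hlam hr 2 2 ((2 : ℝ) • z - iv μ) A hA
    (fun ν hν => ?_) (fun ν hν => ?_) fun S hS hd =>
      card_le_two_of_diam_le (rpow_one_third_pow_three hlam.le) S (hS.trans hA) hd
  · have h := abs_le.1 ((abs_fst_le_e2 _).trans (hz ν hν))
    simp only [iv, Prod.fst_sub, Prod.smul_fst, Prod.fst_add, smul_eq_mul] at h ⊢
    rw [abs_le]
    push_cast
    constructor <;> linarith
  · have h := abs_le.1 ((abs_snd_le_e2 _).trans (hz ν hν))
    simp only [iv, Prod.snd_sub, Prod.smul_snd, Prod.snd_add, smul_eq_mul] at h ⊢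
    rw [abs_le]
    push_cast
    constructor <;> linarith

/-- At most `52 * L * B_lam` lattice points of the circle lie within `(2 * L + 1) * √lam`
of `z`. -/
lemma card_near_le {lam : ℝ} (hlam : 0 < lam) (z : ℝ × ℝ) (l : ℕ)
    (A : Finset (ℤ × ℤ)) (hA : A ⊆ Elat lam)
    (h1 : ∀ μ ∈ A, |(μ.1 : ℝ) - z.1| ≤ (2 * 2 ^ l + 1) * Real.sqrt lam)
    (h2 : ∀ μ ∈ A, |(μ.2 : ℝ) - z.2| ≤ (2 * 2 ^ l + 1) * Real.sqrt lam) :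
    A.card ≤ 52 * 2 ^ l * Bmax lam := by
  have h := card_le_of_card_le_of_diam_le hlam (Real.sqrt_pos.2 hlam) (2 * 2 ^ l + 1) (Bmax lam)
    z A hA (by simpa using h1) (by simpa using h2)
    fun S hS hd => card_le_Bmax hlam.le S (hS.trans hA) hd
  have hl : 1 ≤ 2 ^ l := Nat.one_le_two_pow
  calc A.card ≤ Bmax lam * (4 * (4 * (2 * 2 ^ l + 1) + 1)) := h
    _ ≤ Bmax lam * (52 * 2 ^ l) := Nat.mul_le_mul_left _ (by omega)
    _ = 52 * 2 ^ l * Bmax lam := by ring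

lemma nearSKCount_le {lam ε : ℝ} (hlam : 1 ≤ lam) (hε : ε ≤ 1 / 3) (z : ℝ × ℝ) (l : ℕ) :
    nearSKCount lam ε ((2 : ℝ) ^ l) z ≤ 72 * (52 * 2 ^ l * Bmax lam) := by
  classical
  have hlam0 : 0 < lam := one_pos.trans_le hlam
  have hε3 : lam ^ ε ≤ lam ^ (1 / 3 : ℝ) := Real.rpow_le_rpow_of_exponent_le hlam hε
  have h32 : lam ^ (1 / 3 : ℝ) ≤ Real.sqrt lam := by
    rw [Real.sqrt_eq_rpow]
    exact Real.rpow_le_rpow_of_exponent_le hlam (by norm_num)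
  let med : (ℤ × ℤ) × (ℤ × ℤ) → ℝ × ℝ := fun p => ((1 : ℝ) / 2) • (iv p.1 + iv p.2)
  let P : Finset ((ℤ × ℤ) × (ℤ × ℤ)) := ((Elat lam) ×ˢ (Elat lam)).filter fun p =>
    med p ∈ SK lam ((2 : ℝ) ^ l) ∧ e2 (med p - z) < lam ^ ε
  have hP : ∀ p ∈ P, p.1 ∈ Elat lam ∧ p.2 ∈ Elat lam ∧ med p ∈ SK lam ((2 : ℝ) ^ l) ∧
      e2 (med p - z) < lam ^ ε := by
    intro p hp
    obtain ⟨hp1, hp2⟩ := Finset.mem_filter.1 hp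
    exact ⟨(Finset.mem_product.1 hp1).1, (Finset.mem_product.1 hp1).2, hp2⟩
  have hnear : nearSKCount lam ε ((2 : ℝ) ^ l) z ≤ P.card := by
    unfold nearSKCount
    refine (Finset.card_le_card fun w hw => ?_).trans (Finset.card_image_le (s := P) (f := med))
    obtain ⟨hwS, hwz⟩ := Finset.mem_filter.1 hw
    obtain ⟨p, hp, rfl⟩ := Finset.mem_image.1 (Finset.mem_filter.1 hwS).1
    exact Finset.mem_image.2 ⟨p, Finset.mem_filter.2 ⟨hp, hwS, hwz⟩, rfl⟩
  have hdist : ∀ p ∈ P, e2 (iv p.1 - med p) + e2 (med p - z) ≤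
      (2 * 2 ^ l + 1) * Real.sqrt lam := by
    intro p hp
    obtain ⟨hp1, hp2, hpS, hpz⟩ := hP p hp
    have hD := (Finset.mem_filter.1 hpS).2.2.2
    have hm : e2 (iv p.1 - med p) ≤ Del lam (med p) := e2_sub_median_le_Del hp1 hp2
    linarith
  have hfst : (P.image Prod.fst).card ≤ 52 * 2 ^ l * Bmax lam := by
    refine card_near_le hlam0 z l _ ?_ ?_ ?_
    · exact Finset.image_subset_iff.2 fun p hp => (hP p hp).1
    · refine Finset.forall_mem_image.2 fun p hp => ?_
      calc |(p.1.1 : ℝ) - z.1| = |(iv p.1 - med p).1 + (med p - z).1| := by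
            simp only [Prod.fst_sub, sub_add_sub_cancel, iv]
        _ ≤ _ := (abs_add_le _ _).trans
            ((add_le_add (abs_fst_le_e2 _) (abs_fst_le_e2 _)).trans (hdist p hp))
    · refine Finset.forall_mem_image.2 fun p hp => ?_
      calc |(p.1.2 : ℝ) - z.2| = |(iv p.1 - med p).2 + (med p - z).2| := by
            simp only [Prod.snd_sub, sub_add_sub_cancel, iv]
        _ ≤ _ := (abs_add_le _ _).trans
            ((add_le_add (abs_snd_le_e2 _) (abs_snd_le_e2 _)).trans (hdist p hp))
  have hfib : P.card ≤ 72 * (P.image Prod.fst).card := by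
    refine Finset.card_le_mul_card_image P 72 fun μ _ => ?_
    have hinj : Set.InjOn Prod.snd (SetLike.coe (P.filter fun p => p.1 = μ)) := by
      intro p hp q hq hpq
      exact Prod.ext ((Finset.mem_filter.1 hp).2.trans (Finset.mem_filter.1 hq).2.symm) hpq
    rw [← Finset.card_image_of_injOn (f := Prod.snd) hinj]
    refine card_filter_median_near_le hlam0 z μ _ ?_ ?_
    · exact Finset.image_subset_iff.2 fun p hp => (hP p (Finset.mem_filter.1 hp).1).2.1
    · refine Finset.forall_mem_image.2 fun p hp => ?_
      obtain ⟨hpP, rfl⟩ := Finset.mem_filter.1 hp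
      exact (hP p hpP).2.2.2.le.trans hε3
  exact hnear.trans (hfib.trans (Nat.mul_le_mul_left _ hfst))

/-- Lemma 7.4: for `z ∈ S_K`, the number of `w ∈ S_L` with `|w - z| < lam^ε` is
`O(L · B_lam)`. -/
theorem count_close_medians_in_SL
    (ε : ℝ) (hε0 : 0 < ε) (hε : ε ≤ 1/3) :
    ∃ C > (0:ℝ), ∃ lam0 > (0:ℝ), ∀ lam : ℝ, lam0 ≤ lam →
      ∀ k l : ℕ, ∀ z ∈ SK lam ((2:ℝ) ^ k),
        (nearSKCount lam ε ((2:ℝ) ^ l) z : ℝ) ≤ C * (2:ℝ) ^ l * (Bmax lam : ℝ) := by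
  refine ⟨72 * 52, by norm_num, 1, one_pos, fun lam hlam _ l z _ => ?_⟩
  have h : (nearSKCount lam ε ((2 : ℝ) ^ l) z : ℝ) ≤ 72 * (52 * 2 ^ l * Bmax lam) := by
    exact_mod_cast nearSKCount_le hlam hε z l
  linarith
end
end

section
/- There is an absolute constant c > 0 with the following property. Let λ ≥ 2, let K ≤ L be dyadic integers ≥ 1, let 0 ≤ k ≤ K−1 and 0 ≤ l ≤ L−1, and let z ∈ S_{K,k}, w ∈ S_{L,l} with 0 < |w − z| < λ^{1/3}. Then: (i) if 2K < L then |z − w| ≥ c·L²; (ii) if K = L/2 and l ≥ 1 then |z − w| ≥ c·L·l; (iii) if K = L and |l − k| ≥ 2 then |z − w| ≥ c·L·|l − k|. -/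
open MeasureTheory Real

noncomputable section

/-- The refined dyadic class `S_{L,l} = {w ∈ Z_lam : |w| ≥ lam/2,
(L+l)√lam ≤ Δ(w) < (L+l+1)√lam}`. -/
def SLl (lam K l : ℝ) : Finset (ℝ × ℝ) := by
  classical
  exact (Zmed lam).filter fun w => lam / 2 ≤ e2 w ∧
    (K + l) * Real.sqrt lam ≤ Del lam w ∧ Del lam w < (K + l + 1) * Real.sqrt lam

theorem e2_eq_norm (x : ℝ × ℝ) : e2 x = ‖(⟨x.1, x.2⟩ : ℂ)‖ := by
  rw [e2, Complex.norm_eq_sqrt_sq_add_sq]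

theorem e2_le_add_e2_sub (z w : ℝ × ℝ) : e2 w ≤ e2 z + e2 (z - w) := by
  simp only [e2_eq_norm]
  have h : (⟨w.1, w.2⟩ : ℂ) = ⟨z.1, z.2⟩ - ⟨(z - w).1, (z - w).2⟩ := by
    apply Complex.ext <;> simp
  rw [h]
  exact norm_sub_le _ _

theorem e2_sub_comm (z w : ℝ × ℝ) : e2 (z - w) = e2 (w - z) := by
  unfold e2
  congr 1
  simp only [Prod.fst_sub, Prod.snd_sub]
  ring

/-- If `Δ(z)` and `Δ(w)` are positive then `Δ(z)² - Δ(w)² = |w|² - |z|² ≤ 2·lam·|z - w|`. -/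
theorem sq_Del_sub_sq_Del_le {lam : ℝ} (hlam : 0 ≤ lam) {z w : ℝ × ℝ}
    (hz : 0 < Del lam z) (hw : 0 < Del lam w) :
    Del lam z ^ 2 - Del lam w ^ 2 ≤ 2 * lam * e2 (z - w) := by
  have hz' := Real.sqrt_pos.1 hz
  have hw' := Real.sqrt_pos.1 hw
  have hz0 : 0 ≤ e2 z := Real.sqrt_nonneg _
  have hw0 : 0 ≤ e2 w := Real.sqrt_nonneg _
  have hd0 : 0 ≤ e2 (z - w) := Real.sqrt_nonneg _
  have hzl : e2 z ≤ lam := abs_le_of_sq_le_sq' (by linarith) hlam |>.2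
  have hwl : e2 w ≤ lam := abs_le_of_sq_le_sq' (by linarith) hlam |>.2
  have htri := e2_le_add_e2_sub z w
  rw [Del, Del, Real.sq_sqrt hz'.le, Real.sq_sqrt hw'.le]
  nlinarith [mul_le_mul_of_nonneg_left (sub_le_iff_le_add'.2 htri) (add_nonneg hz0 hw0),
    mul_le_mul_of_nonneg_right (add_le_add hzl hwl) hd0]

/-- If `Δ(z) ≥ a√lam` and `0 < Δ(w) ≤ b√lam` with `0 < b ≤ a`, then
`a² - b² ≤ 2|z - w|`. -/
theorem sq_sub_sq_le_of_Del {lam a b : ℝ} (hlam : 0 < lam) (hb : 0 < b) (hba : b ≤ a)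
    {z w : ℝ × ℝ} (hz : a * √lam ≤ Del lam z) (hw : Del lam w ≤ b * √lam)
    (hw0 : 0 < Del lam w) : a ^ 2 - b ^ 2 ≤ 2 * e2 (z - w) := by
  have hs : 0 < √lam := Real.sqrt_pos.2 hlam
  have ha : 0 < a * √lam := mul_pos (hb.trans_le hba) hs
  have h := sq_Del_sub_sq_Del_le hlam.le (ha.trans_le hz) hw0
  have h1 := pow_le_pow_left₀ ha.le hz 2
  have h2 := pow_le_pow_left₀ hw0.le hw 2
  rw [mul_pow, Real.sq_sqrt hlam.le] at h1 h2
  refine le_of_mul_le_mul_right ?_ hlam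
  linarith

theorem Del_bounds_of_mem_SLl {lam K l : ℝ} {w : ℝ × ℝ} (h : w ∈ SLl lam K l) :
    (K + l) * √lam ≤ Del lam w ∧ Del lam w < (K + l + 1) * √lam := by
  simp only [SLl, Finset.mem_filter] at h
  exact h.2.2

/-- Lemma 7.5: lower bounds for the distance between medians in distinct refined dyadic
classes.  Here `K = 2^kk`, `L = 2^ll` are dyadic with `K ≤ L`, `0 ≤ k ≤ K-1`,
`0 ≤ l ≤ L-1`, `z ∈ S_{K,k}`, `w ∈ S_{L,l}` and `0 < |w - z| < lam^{1/3}`. -/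
theorem median_separation :
    ∃ c > (0:ℝ), ∀ lam : ℝ, 2 ≤ lam →
      ∀ kk ll : ℕ, kk ≤ ll →
      ∀ k l : ℕ, k ≤ 2 ^ kk - 1 → l ≤ 2 ^ ll - 1 →
      ∀ z ∈ SLl lam ((2:ℝ) ^ kk) (k : ℝ), ∀ w ∈ SLl lam ((2:ℝ) ^ ll) (l : ℝ),
        0 < e2 (w - z) → e2 (w - z) < lam ^ ((1:ℝ)/3) →
        (2 * 2 ^ kk < 2 ^ ll → c * ((2:ℝ) ^ ll) ^ 2 ≤ e2 (z - w)) ∧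
        (2 * 2 ^ kk = 2 ^ ll → 1 ≤ l → c * (2:ℝ) ^ ll * (l : ℝ) ≤ e2 (z - w)) ∧
        (kk = ll → 2 ≤ |(l : ℝ) - (k : ℝ)| →
          c * (2:ℝ) ^ ll * |(l : ℝ) - (k : ℝ)| ≤ e2 (z - w)) := by
  refine ⟨1 / 4, by norm_num, ?_⟩
  intro lam hlam kk ll hkl k l hk hl z hz w hw _ _
  have hlam0 : 0 < lam := by linarith
  have hs : 0 < √lam := Real.sqrt_pos.2 hlam0
  obtain ⟨hz1, hz2⟩ := Del_bounds_of_mem_SLl hz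
  obtain ⟨hw1, hw2⟩ := Del_bounds_of_mem_SLl hw
  have hK1 : (1 : ℝ) ≤ 2 ^ kk := one_le_pow₀ (by norm_num)
  have hL1 : (1 : ℝ) ≤ 2 ^ ll := one_le_pow₀ (by norm_num)
  have hk0 : (0 : ℝ) ≤ k := k.cast_nonneg
  have hl0 : (0 : ℝ) ≤ l := l.cast_nonneg
  have hkK : (k : ℝ) + 1 ≤ 2 ^ kk := by
    have : k + 1 ≤ 2 ^ kk := by have := Nat.one_le_two_pow (n := kk); omega
    exact_mod_cast this
  have hzpos : 0 < Del lam z := lt_of_lt_of_le (by positivity) hz1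
  have hwpos : 0 < Del lam w := lt_of_lt_of_le (by positivity) hw1
  rw [e2_sub_comm z w]
  refine ⟨fun h => ?_, fun h hl1 => ?_, fun h hd => ?_⟩
  · have h4 : (4 : ℝ) * 2 ^ kk ≤ 2 ^ ll := by
      have h1 : kk + 1 < ll := by
        rw [← pow_succ'] at h
        exact (Nat.pow_lt_pow_iff_right (by norm_num)).1 h
      have h2 : (2 : ℝ) ^ (kk + 2) ≤ 2 ^ ll := pow_le_pow_right₀ (by norm_num) h1
      rw [pow_add] at h2
      linarith
    have := sq_sub_sq_le_of_Del (a := 2 ^ ll) (b := 2 ^ ll / 2) hlam0 (by positivity)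
      (by linarith) (le_trans (by gcongr; linarith) hw1)
      (hz2.le.trans (by gcongr; linarith)) hzpos
    nlinarith
  · have h2 : (2 : ℝ) * 2 ^ kk = 2 ^ ll := by exact_mod_cast h
    have := sq_sub_sq_le_of_Del (a := 2 ^ ll + l) (b := 2 ^ ll) hlam0 (by positivity)
      (by linarith) hw1 (hz2.le.trans (by gcongr; linarith)) hzpos
    nlinarith
  · subst h
    rcases le_total (k : ℝ) l with hle | hle
    · rw [abs_of_nonneg (by linarith)] at hd ⊢
      have := sq_sub_sq_le_of_Del hlam0 (by positivity) (by linarith) hw1 hz2.le hzpos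
      nlinarith
    · rw [abs_of_nonpos (by linarith)] at hd ⊢
      have := sq_sub_sq_le_of_Del hlam0 (by positivity) (by linarith) hz1 hw2.le hwpos
      rw [e2_sub_comm] at this
      nlinarith
end
end
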